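/- arXiv:2212.02413 — 3 statements merged into one kernel-verified Lean document; each statement's English description precedes it below -/
import Mathlib

section
/- Let N be odd and let C be a unitary N×N complex matrix with C̄C = λ·1 for some complex number λ. Then λ = 1 and C is symmetric (Cᵀ = C). In particular, for odd N there is no unitary charge-conjugation matrix with C̄C = −1. -/
open Matrix

/-- Entrywise complex conjugate of a complex matrix. -/
def mconj {n : Type*} (M : Matrix n n ℂ) : Matrix n n ℂ := M.map (starRingEnd ℂ)

/-- For odd N, any unitary C with C̄C = λ·1 has λ = 1 and C symmetric;
in particular there is no unitary C with C̄C = −1. -/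
theorem stmt7 (N : ℕ) (hN : Odd N) :
    (∀ C : Matrix (Fin N) (Fin N) ℂ, (Cᴴ * C = 1 ∧ C * Cᴴ = 1) →
      ∀ lam : ℂ, mconj C * C = lam • 1 → lam = 1 ∧ Cᵀ = C) ∧
    ¬ ∃ C : Matrix (Fin N) (Fin N) ℂ,
        (Cᴴ * C = 1 ∧ C * Cᴴ = 1) ∧ mconj C * C = -1 := by
  have key : ∀ C : Matrix (Fin N) (Fin N) ℂ, (Cᴴ * C = 1 ∧ C * Cᴴ = 1) →
      ∀ lam : ℂ, mconj C * C = lam • 1 → lam = 1 ∧ Cᵀ = C := by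
    rintro C ⟨h1, h2⟩ lam h
    have h3 : mconj C = lam • Cᴴ := by
      calc mconj C = mconj C * (C * Cᴴ) := by rw [h2, mul_one]
        _ = lam • Cᴴ := by rw [← mul_assoc, h, smul_mul_assoc, one_mul]
    have h4 : Cᵀ = star lam • C := by
      have h5 := congrArg Matrix.conjTranspose h3
      rw [Matrix.conjTranspose_smul, Matrix.conjTranspose_conjTranspose] at h5
      rw [← h5]
      ext i j
      simp [mconj, Matrix.conjTranspose_apply]
    have h6 : C = (star lam * star lam) • C := by
      have h5 := congrArg Matrix.transpose h4
      rw [Matrix.transpose_smul, Matrix.transpose_transpose, h4, smul_smul] at h5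
      exact h5
    have hd : C.det ≠ 0 := by
      intro h0
      have h5 := congrArg Matrix.det h2
      rw [Matrix.det_mul, h0, zero_mul, Matrix.det_one] at h5
      exact zero_ne_one h5
    have h7 : star lam * star lam = 1 := by
      have hC : C ≠ 0 := by
        rintro rfl
        apply hd
        have : Nonempty (Fin N) := ⟨⟨0, hN.pos⟩⟩
        exact Matrix.det_zero
      by_contra hne
      apply hC
      have h8 : (1 - star lam * star lam) • C = 0 := by
        rw [sub_smul, one_smul, ← h6, sub_self]
      exact (smul_eq_zero.mp h8).resolve_left (sub_ne_zero.mpr (Ne.symm hne))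
    have h9 : star lam ^ N = 1 := by
      have h5 := congrArg Matrix.det h4
      rw [Matrix.det_transpose, Matrix.det_smul, Fintype.card_fin] at h5
      exact mul_right_cancel₀ hd (by rw [← h5, one_mul])
    have h10 : star lam = 1 := by
      obtain ⟨k, hk⟩ := hN
      rw [hk, pow_succ, pow_mul, pow_two, h7, one_pow, one_mul] at h9
      exact h9
    refine ⟨by rw [← star_star lam, h10, star_one], ?_⟩
    rw [h4, h10, one_smul]
  refine ⟨key, ?_⟩
  rintro ⟨C, hC, h⟩
  have := (key C hC (-1) (by rw [h, neg_smul, one_smul])).1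
  norm_num at this
end

section
/- Let G be a group and ρ a representation of G on the complex vector space ℂᴺ (N ≥ 1) that is irreducible, i.e. the only subspaces W ⊆ ℂᴺ with ρ(g)W ⊆ W for all g ∈ G are {0} and ℂᴺ. Let C be a unitary N×N complex matrix such that C̄C commutes with ρ(g) for every g ∈ G. Then C̄C = 1 or C̄C = −1; in the first case C is symmetric and in the second case C is antisymmetric. -/
open Matrix

/-- Schur-type result: if ρ is an irreducible representation of a group G on ℂᴺ
and C is unitary with C̄C commuting with every ρ(g), then C̄C = 1 (and C is
symmetric) or C̄C = −1 (and C is antisymmetric). -/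
theorem stmt10 (N : ℕ) (hN : 1 ≤ N) (G : Type*) [Group G]
    (ρ : G → Matrix (Fin N) (Fin N) ℂ)
    (hρ_inv : ∀ g : G, IsUnit (ρ g))
    (hρ_mul : ∀ g h : G, ρ (g * h) = ρ g * ρ h)
    (hρ_one : ρ 1 = 1)
    (hirr : ∀ W : Submodule ℂ (Fin N → ℂ),
      (∀ g : G, ∀ v ∈ W, (ρ g).mulVec v ∈ W) → W = ⊥ ∨ W = ⊤)
    (C : Matrix (Fin N) (Fin N) ℂ)
    (hC : Cᴴ * C = 1 ∧ C * Cᴴ = 1)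
    (hcomm : ∀ g : G, (mconj C * C) * ρ g = ρ g * (mconj C * C)) :
    (mconj C * C = 1 ∧ Cᵀ = C) ∨ (mconj C * C = -1 ∧ Cᵀ = -C) := by
  have hT : Cᵀ * mconj C = 1 := by
    have h := congrArg Matrix.transpose hC.1
    rw [Matrix.transpose_mul, Matrix.transpose_one] at h
    exact h
  haveI : Nonempty (Fin N) := ⟨⟨0, hN⟩⟩
  obtain ⟨μ, hμ⟩ := Module.End.exists_eigenvalue (Matrix.toLin' (mconj C * C))
  have htop : Module.End.eigenspace (Matrix.toLin' (mconj C * C)) μ = ⊤ := by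
    refine (hirr _ ?_).resolve_left hμ
    intro g v hv
    rw [Module.End.mem_eigenspace_iff, Matrix.toLin'_apply] at hv ⊢
    rw [Matrix.mulVec_mulVec, hcomm g, ← Matrix.mulVec_mulVec, hv, Matrix.mulVec_smul]
  have hs : mconj C * C = μ • (1 : Matrix (Fin N) (Fin N) ℂ) := by
    apply Matrix.toLin'.injective
    ext1 v
    ext1
    have hv : (LinearMap.single ℂ (fun _ : Fin N => ℂ) v 1) ∈
        Module.End.eigenspace (Matrix.toLin' (mconj C * C)) μ := by
      rw [htop]; trivial
    rw [Module.End.mem_eigenspace_iff] at hv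
    simpa using hv
  have h1 : C = μ • Cᵀ := by
    have h := congrArg (fun M => Cᵀ * M) hs
    simpa [← Matrix.mul_assoc, hT] using h
  have h2 : Cᵀ = μ • C := by
    have h := congrArg Matrix.transpose h1
    simpa using h
  have hC0 : C ≠ 0 := by
    intro h0
    have h := hC.1
    rw [h0, Matrix.mul_zero] at h
    exact zero_ne_one h
  have hsq : μ * μ = 1 := by
    have h3 : (μ * μ - 1) • C = 0 := by
      rw [sub_smul, mul_smul, ← h2, ← h1, one_smul, sub_self]
    exact sub_eq_zero.mp ((smul_eq_zero.mp h3).resolve_right hC0)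
  rcases mul_self_eq_one_iff.mp hsq with h | h
  · left
    rw [hs, h2, h]
    simp
  · right
    rw [hs, h2, h]
    simp
end

section
/- Let N ≥ 1, let J be the 2N×2N matrix block-diagonal with N copies of [[0,1],[−1,0]], and for a 2N×2N matrix M let 𝒞(M) = [[0, M̄],[M, 0]] (a 4N×4N matrix). Then the two cosets coincide: { diag(g, ḡ) · 𝒞(1₂ₙ) : g ∈ SU(2N) } = { diag(g, ḡ) · 𝒞(J) : g ∈ SU(2N) }. Hence the extensions of the block-embedded SU(2N) by the symmetric and by the antisymmetric charge conjugation are equal as sets of matrices, SU(2N) ⋊ Γ_{𝒞_S} = SU(2N) ⋊ Γ_{𝒞_A}. -/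
open Matrix Kronecker

/-- The 2N×2N matrix that is block diagonal with N copies of [[0,1],[−1,0]]. -/
def Jmat (N : ℕ) : Matrix (Fin N × Fin 2) (Fin N × Fin 2) ℂ :=
  (1 : Matrix (Fin N) (Fin N) ℂ) ⊗ₖ !![0, 1; -1, 0]

/-- The charge-conjugation block matrix 𝒞(M) = [[0, M̄],[M, 0]]. -/
def Cmat {n : Type*} (M : Matrix n n ℂ) : Matrix (n ⊕ n) (n ⊕ n) ℂ :=
  fromBlocks 0 (mconj M) M 0

lemma mconj_mul' {n : Type*} [Fintype n] (A B : Matrix n n ℂ) :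
    mconj (A * B) = mconj A * mconj B := by
  simp [mconj, Matrix.map_mul]

lemma mconj_J (N : ℕ) : mconj (Jmat N) = Jmat N := by
  ext ⟨i, a⟩ ⟨j, b⟩
  fin_cases a <;> fin_cases b <;> simp [mconj, Jmat, Matrix.one_apply, apply_ite]

lemma J_sq (N : ℕ) : Jmat N * Jmat N = -1 := by
  unfold Jmat
  rw [← Matrix.mul_kronecker_mul]
  ext ⟨i, a⟩ ⟨j, b⟩
  fin_cases a <;> fin_cases b <;> simp [Matrix.one_apply]
  all_goals split_ifs <;> simp

lemma J_herm (N : ℕ) : (Jmat N)ᴴ = -Jmat N := by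
  ext ⟨i, a⟩ ⟨j, b⟩
  fin_cases a <;> fin_cases b <;>
    simp [Jmat, Matrix.one_apply, apply_ite, eq_comm]

lemma J_det (N : ℕ) : (Jmat N).det = 1 := by
  simp [Jmat, Matrix.det_kronecker, Matrix.det_fin_two]

lemma mulJ_su (N : ℕ) (g : Matrix (Fin N × Fin 2) (Fin N × Fin 2) ℂ)
    (h : gᴴ * g = 1 ∧ g * gᴴ = 1 ∧ g.det = 1) :
    (g * Jmat N)ᴴ * (g * Jmat N) = 1 ∧ (g * Jmat N) * (g * Jmat N)ᴴ = 1 ∧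
      (g * Jmat N).det = 1 := by
  obtain ⟨h1, h2, h3⟩ := h
  have key : (g * Jmat N) * (g * Jmat N)ᴴ = 1 := by
    rw [Matrix.conjTranspose_mul, J_herm, Matrix.mul_assoc, ← Matrix.mul_assoc (Jmat N),
      Matrix.mul_neg, J_sq, neg_neg, Matrix.one_mul, h2]
  exact ⟨mul_eq_one_comm.mp key, key, by rw [Matrix.det_mul, h3, J_det, one_mul]⟩

lemma coset_eq (N : ℕ) (g M : Matrix (Fin N × Fin 2) (Fin N × Fin 2) ℂ) :
    fromBlocks g 0 0 (mconj g) * Cmat M = fromBlocks 0 (g * mconj M) (mconj g * M) 0 := by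
  simp [Cmat, Matrix.fromBlocks_multiply]

lemma mconj_one' (N : ℕ) :
    mconj (1 : Matrix (Fin N × Fin 2) (Fin N × Fin 2) ℂ) = 1 := by
  simp [mconj]

/-- The cosets of the block-embedded SU(2N) by the symmetric charge conjugation
𝒞(1₂ₙ) and by the antisymmetric one 𝒞(J) coincide; hence the corresponding
extensions SU(2N) ⋊ Γ_{𝒞_S} and SU(2N) ⋊ Γ_{𝒞_A} are equal as sets of matrices. -/
theorem stmt16 (N : ℕ) (hN : 1 ≤ N) :
    {A : Matrix ((Fin N × Fin 2) ⊕ (Fin N × Fin 2))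
        ((Fin N × Fin 2) ⊕ (Fin N × Fin 2)) ℂ |
      ∃ g : Matrix (Fin N × Fin 2) (Fin N × Fin 2) ℂ,
        (gᴴ * g = 1 ∧ g * gᴴ = 1 ∧ g.det = 1) ∧
        A = fromBlocks g 0 0 (mconj g) *
          Cmat (1 : Matrix (Fin N × Fin 2) (Fin N × Fin 2) ℂ)} =
    {A : Matrix ((Fin N × Fin 2) ⊕ (Fin N × Fin 2))
        ((Fin N × Fin 2) ⊕ (Fin N × Fin 2)) ℂ |
      ∃ g : Matrix (Fin N × Fin 2) (Fin N × Fin 2) ℂ,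
        (gᴴ * g = 1 ∧ g * gᴴ = 1 ∧ g.det = 1) ∧
        A = fromBlocks g 0 0 (mconj g) * Cmat (Jmat N)} := by
  ext A
  simp only [Set.mem_setOf_eq, coset_eq, mconj_one', mconj_J, Matrix.mul_one]
  constructor
  · rintro ⟨g, hg, rfl⟩
    refine ⟨g * Jmat N * Jmat N * Jmat N,
      mulJ_su N _ (mulJ_su N _ (mulJ_su N g hg)), ?_⟩
    simp only [mconj_mul', mconj_J]
    simp [Matrix.mul_assoc, J_sq]
  · rintro ⟨g, hg, rfl⟩
    exact ⟨g * Jmat N, mulJ_su N g hg, by rw [mconj_mul', mconj_J]⟩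
end
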